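/- arXiv:2508.13289 — 2 statements merged into one kernel-verified Lean document; each statement's English description precedes it below -/
import Mathlib

section
/- Let X be an n-correct set, μ a maximal curve for X of degree k ≤ n, B := X \ μ, A := X ∩ μ, and let {A,B,C} with A ∈ A, B ∈ B, C ∈ X be a special triplet of X, so that μ = ℓ₁·μ_{k−1} where ℓ₁ = ℓ_{AC}, and set ℓ̇₁ := {M ∈ ℓ₁ ∩ X : μ_{k−1}(M) ≠ 0}. Then: (1) μ_{k−1} = μ/ℓ₁ is a maximal curve for X of degree k−1; (2) the set B_{n−k+1} := X \ μ_{k−1} = B ∪ ℓ̇₁ is an (n−k+1)-correct set for which ℓ₁ is a maximal line; (3) X ∩ μ_{k−1} = A \ ℓ̇₁; (4) {A,B,C} is also a special triplet of B_{n−k+1}; (5) if {B,D,E} ⊆ X is a special triplet of X with D ∈ ℓ̇₁, then {D,E} = {A,C}. -/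
open MvPolynomial Finset
open scoped Classical BigOperators

noncomputable section

/-- Points of the plane. -/
abbrev Pt : Type := Fin 2 → ℝ

/-- Bivariate real polynomials. -/
abbrev Poly2 : Type := MvPolynomial (Fin 2) ℝ

/-- `N = dim Π_n = (n+1)(n+2)/2`. -/
def Nn (n : ℕ) : ℕ := (n + 1) * (n + 2) / 2

/-- `X` is an `n`-correct set of nodes: it has `N` nodes and the only polynomial of total
degree at most `n` vanishing at all of them is the zero polynomial. -/
def IsNCorrect (n : ℕ) (X : Finset Pt) : Prop :=
  X.card = Nn n ∧
  ∀ p : Poly2, p.totalDegree ≤ n → (∀ P ∈ X, eval P p = 0) → p = 0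

/-- A line: a (nonzero) polynomial of total degree exactly 1. -/
def IsLine (ℓ : Poly2) : Prop := ℓ.totalDegree = 1

/-- The zero set of a polynomial, as a subset of the plane. -/
def zeroSet (q : Poly2) : Set Pt := {P : Pt | eval P q = 0}

/-- `X ∩ q` : the nodes of `X` lying on the curve `q`. -/
def zerosIn (X : Finset Pt) (q : Poly2) : Finset Pt := X.filter fun P => eval P q = 0

/-- `X \ q` : the nodes of `X` not lying on the curve `q`. -/
def nonzerosIn (X : Finset Pt) (q : Poly2) : Finset Pt := X.filter fun P => eval P q ≠ 0

/-- `ℓ` is a maximal line for (an `n`-correct set) `X`: a line passing through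
exactly `n+1` nodes. -/
def IsMaximalLine (n : ℕ) (X : Finset Pt) (ℓ : Poly2) : Prop :=
  IsLine ℓ ∧ (zerosIn X ℓ).card = n + 1

/-- The collection of maximal lines of `X` (as subsets of the plane). -/
def maximalLines (n : ℕ) (X : Finset Pt) : Set (Set Pt) :=
  {Z : Set Pt | ∃ ℓ : Poly2, IsMaximalLine n X ℓ ∧ Z = zeroSet ℓ}

/-- `p` is the `n`-fundamental polynomial of the node `A` of `X`. -/
def IsFund (n : ℕ) (X : Finset Pt) (A : Pt) (p : Poly2) : Prop :=
  p.totalDegree ≤ n ∧ eval A p = 1 ∧ ∀ P ∈ X, P ≠ A → eval P p = 0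

/-- The node `A` of `X` uses the curve `q`: `q` divides the fundamental polynomial of `A`. -/
def Uses (n : ℕ) (X : Finset Pt) (A : Pt) (q : Poly2) : Prop :=
  ∃ p : Poly2, IsFund n X A p ∧ q ∣ p

/-- `d(n,k) = k(2n+3-k)/2`. -/
def d (n k : ℕ) : ℕ := k * (2 * n + 3 - k) / 2

/-- `q` is a maximal curve of degree `k` for `X`: it passes through exactly `d(n,k)` nodes. -/
def IsMaximalCurve (n k : ℕ) (X : Finset Pt) (q : Poly2) : Prop :=
  q.totalDegree = k ∧ (zerosIn X q).card = d n k

/-- `{A,B,C}` is a special triplet of the `n`-correct set `X` : there is a maximal curve `f`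
of degree `n-1` with `X \ f = {A,B,C}`. -/
def IsSpecialTriplet (n : ℕ) (X : Finset Pt) (A B C : Pt) : Prop :=
  A ∈ X ∧ B ∈ X ∧ C ∈ X ∧ A ≠ B ∧ A ≠ C ∧ B ≠ C ∧
  ∃ f : Poly2, IsMaximalCurve n (n - 1) X f ∧ nonzerosIn X f = {A, B, C}

/-- `X` is a `GC_n` set: an `n`-correct set in which every fundamental polynomial is a
product of `n` linear factors. -/
def IsGC (n : ℕ) (X : Finset Pt) : Prop :=
  IsNCorrect n X ∧
  ∀ A ∈ X, ∃ p : Poly2, IsFund n X A p ∧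
    ∃ g : Fin n → Poly2, (∀ i, (g i).totalDegree = 1) ∧ p = ∏ i, g i

/-- `ℓ` is a line passing through the points `P` and `Q` (in particular, `ℓ_{PQ}` when
`P ≠ Q`). -/
def IsLineThrough (ℓ : Poly2) (P Q : Pt) : Prop :=
  IsLine ℓ ∧ eval P ℓ = 0 ∧ eval Q ℓ = 0

/-- `ℓ` is a `2`-node line of `X` passing through exactly the two nodes `A` and `B`. -/
def IsTwoNodeLineOf (X : Finset Pt) (ℓ : Poly2) (A B : Pt) : Prop :=
  IsLine ℓ ∧ A ≠ B ∧ zerosIn X ℓ = {A, B}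

/-- `Y` is an `n`-independent set: every point has an `n`-fundamental polynomial. -/
def IsNIndependent (n : ℕ) (Y : Finset Pt) : Prop :=
  ∀ A ∈ Y, ∃ p : Poly2, p.totalDegree ≤ n ∧ eval A p ≠ 0 ∧
    ∀ P ∈ Y, P ≠ A → eval P p = 0

/-- A family of lines is in general position: no two parallel (or equal) — i.e. any two of
them meet in a unique point — and no three concurrent. -/
def GenPos {m : ℕ} (ℓ : Fin m → Poly2) : Prop :=
  (∀ i, IsLine (ℓ i)) ∧
  (∀ i j, i ≠ j → ∃! P : Pt, eval P (ℓ i) = 0 ∧ eval P (ℓ j) = 0) ∧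
  (∀ i j k, i ≠ j → i ≠ k → j ≠ k →
    ¬∃ P : Pt, eval P (ℓ i) = 0 ∧ eval P (ℓ j) = 0 ∧ eval P (ℓ k) = 0)

/-- `X` is a Chung–Yao set of degree `n`: the set of pairwise intersection points of `n+2`
lines in general position. -/
def IsChungYao (n : ℕ) (X : Finset Pt) : Prop :=
  ∃ ℓ : Fin (n + 2) → Poly2, GenPos ℓ ∧
    (↑X : Set Pt) = {P : Pt | ∃ i j, i ≠ j ∧ eval P (ℓ i) = 0 ∧ eval P (ℓ j) = 0}

/-- `X` is a Carnicer–Gasca set of degree `n`: the pairwise intersection points of `n+1`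
lines in general position together with one extra point `A i` on each line `ℓ i`, the `A i`
lying on no other line of the family and not all collinear. -/
def IsCarnicerGasca (n : ℕ) (X : Finset Pt) : Prop :=
  ∃ (ℓ : Fin (n + 1) → Poly2) (A : Fin (n + 1) → Pt), GenPos ℓ ∧
    (∀ i j, eval (A i) (ℓ j) = 0 ↔ j = i) ∧
    (¬∃ L : Poly2, IsLine L ∧ ∀ i, eval (A i) L = 0) ∧
    (↑X : Set Pt) =
      {P : Pt | ∃ i j, i ≠ j ∧ eval P (ℓ i) = 0 ∧ eval P (ℓ j) = 0} ∪ Set.range A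

lemma two_mul_Nn (m : ℕ) : 2 * Nn m = (m + 1) * (m + 2) :=
  Nat.mul_div_cancel' (Nat.even_mul_succ_self (m + 1)).two_dvd

lemma d_add_Nn (k m : ℕ) : d (k + m) k + Nn m = Nn (k + m) := by
  have h1 := two_mul_Nn m
  have h2 := two_mul_Nn (k + m)
  have h3 : 2 * d (k + m) k = k * (k + 2 * m + 3) := by
    have e : 2 * (k + m) + 3 - k = k + 2 * m + 3 := by omega
    rw [d, e]
    refine Nat.mul_div_cancel' (Even.two_dvd ?_)
    rw [show k * (k + 2 * m + 3) = k * (k + 1) + 2 * (k * (m + 1)) by ring]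
    exact (Nat.even_mul_succ_self k).add (even_two_mul _)
  nlinarith

lemma Nn_succ (m : ℕ) : Nn (m + 1) = Nn m + (m + 2) := by
  have h1 := two_mul_Nn m
  have h2 := two_mul_Nn (m + 1)
  nlinarith

lemma sum_range_succ_eq_Nn (m : ℕ) : ∑ i ∈ Finset.range (m + 1), (i + 1) = Nn m := by
  induction m with
  | zero => rfl
  | succ m ih => rw [Finset.sum_range_succ, ih, Nn_succ]

/-- The space of bivariate polynomials of total degree at most `m` has dimension at least
`Nn m`. -/
lemma Nn_le_finrank (m : ℕ) :
    Nn m ≤ Module.finrank ℝ (restrictTotalDegree (Fin 2) ℝ m) := by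
  let S : Set (Fin 2 →₀ ℕ) := {s | (s.sum fun _ e => e) ≤ m}
  let b : Module.Basis S ℝ (restrictTotalDegree (Fin 2) ℝ m) := basisRestrictSupport ℝ S
  have : Finite S := Module.Finite.finite_basis b
  let T : Finset (Σ _ : ℕ, ℕ × ℕ) := (Finset.range (m + 1)).sigma fun i => antidiagonal i
  have hT : T.card = Nn m := by
    simp only [T, Finset.card_sigma, Finset.Nat.card_antidiagonal, sum_range_succ_eq_Nn]
  rw [Module.finrank_eq_nat_card_basis b, ← hT, ← Nat.card_eq_finsetCard]
  let g : T → S := fun x => ⟨Finsupp.single 0 x.1.2.1 + Finsupp.single 1 x.1.2.2, by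
    obtain ⟨h1, h2⟩ := Finset.mem_sigma.1 x.2
    rw [Finset.mem_range] at h1
    rw [HasAntidiagonal.mem_antidiagonal] at h2
    change (Finsupp.sum _ fun _ e => e) ≤ m
    rw [Finsupp.sum_fintype _ _ fun _ => rfl, Fin.sum_univ_two]
    simp
    omega⟩
  refine Nat.card_le_card_of_injective g fun x y hxy => ?_
  obtain ⟨⟨i, a, b⟩, hx⟩ := x
  obtain ⟨⟨j, c, e⟩, hy⟩ := y
  have hx2 := HasAntidiagonal.mem_antidiagonal.1 (Finset.mem_sigma.1 hx).2
  have hy2 := HasAntidiagonal.mem_antidiagonal.1 (Finset.mem_sigma.1 hy).2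
  have h0 := DFunLike.congr_fun (congrArg Subtype.val hxy) 0
  have h1 := DFunLike.congr_fun (congrArg Subtype.val hxy) 1
  simp [g] at h0 h1
  simp only at hx2 hy2
  subst h0 h1 hx2 hy2
  rfl

/-- Evaluation at the points of `Y`, on polynomials of total degree at most `m`. -/
def evalOn (m : ℕ) (Y : Finset Pt) : restrictTotalDegree (Fin 2) ℝ m →ₗ[ℝ] (Y → ℝ) where
  toFun p P := eval P.1 p.1
  map_add' p q := by ext P; simp
  map_smul' c p := by ext P; simp

lemma evalOn_injective {m : ℕ} {Y : Finset Pt}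
    (h : ∀ p : Poly2, p.totalDegree ≤ m → (∀ P ∈ Y, eval P p = 0) → p = 0) :
    Function.Injective (evalOn m Y) := by
  rw [injective_iff_map_eq_zero]
  rintro ⟨p, hp⟩ h0
  rw [mem_restrictTotalDegree] at hp
  exact Subtype.ext (h p hp fun P hP => congrFun h0 ⟨P, hP⟩)

lemma Nn_le_card {m : ℕ} {Y : Finset Pt}
    (h : ∀ p : Poly2, p.totalDegree ≤ m → (∀ P ∈ Y, eval P p = 0) → p = 0) :
    Nn m ≤ Y.card := by
  have := LinearMap.finrank_le_finrank_of_injective (evalOn_injective h)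
  rw [Module.finrank_fintype_fun_eq_card, Fintype.card_coe] at this
  exact (Nn_le_finrank m).trans this

lemma exists_isFund {m : ℕ} {Y : Finset Pt} (hY : IsNCorrect m Y) {A : Pt} (hA : A ∈ Y) :
    ∃ p, IsFund m Y A p := by
  have hinj := evalOn_injective hY.2
  have hle := LinearMap.finrank_le_finrank_of_injective hinj
  have hfr : Module.finrank ℝ (Y → ℝ) = Nn m := by
    rw [Module.finrank_fintype_fun_eq_card, Fintype.card_coe, hY.1]
  have heq : Module.finrank ℝ (restrictTotalDegree (Fin 2) ℝ m) = Module.finrank ℝ (Y → ℝ) :=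
    le_antisymm hle (hfr ▸ Nn_le_finrank m)
  obtain ⟨⟨p, hp⟩, h⟩ :=
    (LinearMap.injective_iff_surjective_of_finrank_eq_finrank heq).1 hinj
      (Pi.single ⟨A, hA⟩ 1)
  refine ⟨p, (mem_restrictTotalDegree _ _ _).1 hp, ?_, fun P hP hne => ?_⟩
  · simpa [evalOn] using congrFun h ⟨A, hA⟩
  · have := congrFun h ⟨P, hP⟩
    rwa [Pi.single_eq_of_ne (fun e => hne (congrArg Subtype.val e))] at this

/-- Two polynomials of degree at most `n` vanishing on `X` except at `B` are proportional. -/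
lemma proportional_of_vanish {n : ℕ} {X : Finset Pt} (hX : IsNCorrect n X) {B : Pt}
    {p q : Poly2} (hp : p.totalDegree ≤ n) (hq : q.totalDegree ≤ n)
    (hp0 : ∀ P ∈ X, P ≠ B → eval P p = 0) (hq0 : ∀ P ∈ X, P ≠ B → eval P q = 0) :
    C (eval B q) * p = C (eval B p) * q := by
  rw [← sub_eq_zero]
  refine hX.2 _ ?_ fun P hP => ?_
  · refine (totalDegree_sub _ _).trans (max_le ?_ ?_)
    · exact (totalDegree_mul _ _).trans (by simpa using hp)
    · exact (totalDegree_mul _ _).trans (by simpa using hq)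
  · by_cases h : P = B
    · subst h; simp [mul_comm]
    · simp [hp0 P hP h, hq0 P hP h]

lemma exists_affine_of_totalDegree_le_one {p : Poly2} (hp : p.totalDegree ≤ 1) :
    ∃ a b c : ℝ, p = C a * X 0 + C b * X 1 + C c := by
  refine ⟨coeff (Finsupp.single 0 1) p, coeff (Finsupp.single 1 1) p, coeff 0 p, ?_⟩
  ext s
  have h01 : (Finsupp.single 0 1 : Fin 2 →₀ ℕ) ≠ Finsupp.single 1 1 := by
    intro h; simpa using DFunLike.congr_fun h 0
  have h10 := h01.symm
  simp only [coeff_add, coeff_C_mul, coeff_X, coeff_C]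
  by_cases h0 : s = 0
  · subst h0; simp
  by_cases h1 : s = Finsupp.single 0 1
  · subst h1; simp [h10, Ne.symm h0]
  by_cases h2 : s = Finsupp.single 1 1
  · subst h2; simp [h01, Ne.symm h0]
  rw [if_neg (Ne.symm h1), if_neg (Ne.symm h2), if_neg (Ne.symm h0)]
  simp only [mul_zero, add_zero]
  by_contra hc
  have hle := (le_totalDegree (mem_support_iff.2 hc)).trans hp
  rw [Finsupp.sum_fintype _ _ (fun _ => rfl), Fin.sum_univ_two] at hle
  have hcases : (s 0 = 0 ∧ s 1 = 0) ∨ (s 0 = 1 ∧ s 1 = 0) ∨ (s 0 = 0 ∧ s 1 = 1) := by omega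
  rcases hcases with ⟨e0, e1⟩ | ⟨e0, e1⟩ | ⟨e0, e1⟩
  · exact h0 (by ext i; fin_cases i <;> simp [e0, e1])
  · exact h1 (by ext i; fin_cases i <;> simp [e0, e1])
  · exact h2 (by ext i; fin_cases i <;> simp [e0, e1])

lemma IsLineThrough.exists_eq_add_smul {ℓ : Poly2} {A B : Pt} (h : IsLineThrough ℓ A B)
    (hAB : A ≠ B) {P : Pt} (hP : eval P ℓ = 0) : ∃ t : ℝ, P = A + t • (B - A) := by
  obtain ⟨hℓ, hA, hB⟩ := h
  obtain ⟨a, b, c, rfl⟩ := exists_affine_of_totalDegree_le_one (le_of_eq hℓ)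
  have hab : a ≠ 0 ∨ b ≠ 0 := by
    by_contra! hn
    simp [IsLine, hn.1, hn.2] at hℓ
  simp only [map_add, map_mul, eval_C, eval_X] at hA hB hP
  have hdet : (B 0 - A 0) * (P 1 - A 1) = (B 1 - A 1) * (P 0 - A 0) := by
    rcases hab with ha | hb
    · apply mul_left_cancel₀ ha
      linear_combination (P 1 - A 1) * (hB - hA) - (B 1 - A 1) * (hP - hA)
    · apply mul_left_cancel₀ hb
      linear_combination (B 0 - A 0) * (hP - hA) - (P 0 - A 0) * (hB - hA)
  have hne : B 0 - A 0 ≠ 0 ∨ B 1 - A 1 ≠ 0 := by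
    by_contra! hn
    exact hAB (by ext i; fin_cases i <;> simp <;> linarith [hn.1, hn.2])
  rcases hne with h0 | h1
  · refine ⟨(P 0 - A 0) / (B 0 - A 0), ?_⟩
    ext i; fin_cases i <;> simp <;> field_simp <;> linarith
  · refine ⟨(P 1 - A 1) / (B 1 - A 1), ?_⟩
    ext i; fin_cases i <;> simp <;> field_simp <;> linarith

/-- A polynomial of degree at most `m` that does not vanish identically on a line has at most
`m` zeros on it. -/
lemma card_le_of_zeros_on_line {ℓ q : Poly2} {A B : Pt} {m : ℕ} (h : IsLineThrough ℓ A B)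
    (hAB : A ≠ B) (hq : q.totalDegree ≤ m) (hqA : eval A q ≠ 0) {Z : Finset Pt}
    (hZ : ∀ P ∈ Z, eval P ℓ = 0 ∧ eval P q = 0) : Z.card ≤ m := by
  let g : Fin 2 → Polynomial ℝ := fun i =>
    Polynomial.C (A i) + Polynomial.X * Polynomial.C (B i - A i)
  let r : Polynomial ℝ := aeval g q
  have hr (t : ℝ) : r.eval t = eval (A + t • (B - A)) q := by
    simp only [r]
    rw [← Polynomial.coe_evalRingHom, ← RingHom.coe_coe (aeval g), ← RingHom.comp_apply]
    congr 1
    apply MvPolynomial.ringHom_ext <;> intro i <;> simp [g]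
  have hr0 : r ≠ 0 := by
    intro h0
    apply hqA
    simpa [h0] using (hr 0).symm
  have hdeg : r.natDegree ≤ m := by
    have hg (i : Fin 2) : (g i).natDegree ≤ 1 := by
      simp only [g]; compute_degree
    simpa using aeval_natDegree_le q hq g hg
  choose! t ht using fun P hP => h.exists_eq_add_smul hAB (hZ P hP).1
  calc Z.card ≤ r.roots.toFinset.card := by
        refine Finset.card_le_card_of_injOn t (fun P hP => ?_) fun P hP Q hQ e => ?_
        · simp only [Finset.mem_coe, Multiset.mem_toFinset, Polynomial.mem_roots hr0,
            Polynomial.IsRoot.def]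
          rw [hr, ← ht P hP, (hZ P hP).2]
        · rw [ht P hP, ht Q hQ, e]
    _ ≤ r.roots.card := Multiset.toFinset_card_le _
    _ ≤ m := (Polynomial.card_roots' r).trans hdeg

lemma exists_line_through {A B : Pt} (hAB : A ≠ B) : ∃ ℓ : Poly2, IsLineThrough ℓ A B := by
  let ℓ : Poly2 := C (B 1 - A 1) * (X 0 - C (A 0)) - C (B 0 - A 0) * (X 1 - C (A 1))
  have hA : eval A ℓ = 0 := by simp [ℓ]
  have hB : eval B ℓ = 0 := by simp [ℓ]; ring
  refine ⟨ℓ, le_antisymm ?_ (Nat.one_le_iff_ne_zero.2 fun h0 => hAB ?_), hA, hB⟩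
  · have hX (i : Fin 2) (c e : ℝ) : (C c * (X i - C e) : Poly2).totalDegree ≤ 1 := by
      refine (totalDegree_mul _ _).trans ?_
      rw [totalDegree_C, zero_add]
      exact (totalDegree_sub _ _).trans (by simp)
    exact (totalDegree_sub _ _).trans (max_le (hX _ _ _) (hX _ _ _))
  · rw [totalDegree_eq_zero_iff_eq_C] at h0
    have hc : coeff 0 ℓ = 0 := by rw [h0] at hA; simpa using hA
    rw [hc, C_0] at h0
    have e0 : eval (A + Pi.single 0 1) ℓ = 0 := by rw [h0]; simp
    have e1 : eval (A + Pi.single 1 1) ℓ = 0 := by rw [h0]; simp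
    simp [ℓ] at e0 e1
    ext i; fin_cases i <;> simp <;> linarith

lemma IsLine.prime {ℓ : Poly2} (h : IsLine ℓ) : Prime ℓ := by
  refine (irreducible_of_totalDegree_eq_one h fun x hx => isUnit_iff_ne_zero.2 ?_).prime
  rintro rfl
  have h0 : ℓ = 0 := by ext i; simpa using hx i
  simp [IsLine, h0] at h

lemma IsLine.ne_zero {ℓ : Poly2} (h : IsLine ℓ) : ℓ ≠ 0 := by
  rintro rfl
  simp [IsLine] at h

lemma card_zerosIn_add_card_nonzerosIn (X : Finset Pt) (q : Poly2) :
    (zerosIn X q).card + (nonzerosIn X q).card = X.card :=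
  Finset.card_filter_add_card_filter_not _

/-- The only polynomial of degree at most `m` vanishing on the nodes outside a curve of degree
at most `j` is zero, if `j + m ≤ n`. -/
lemma IsNCorrect.eq_zero_of_vanish_nonzerosIn {n j m : ℕ} {X : Finset Pt}
    (hX : IsNCorrect n X) {q : Poly2} (hq0 : q ≠ 0) (hq : q.totalDegree ≤ j) (hjm : j + m ≤ n)
    (p : Poly2) (hp : p.totalDegree ≤ m) (h : ∀ P ∈ nonzerosIn X q, eval P p = 0) :
    p = 0 := by
  have : q * p = 0 := by
    refine hX.2 _ ((totalDegree_mul _ _).trans (by omega)) fun P hP => ?_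
    by_cases hPq : eval P q = 0
    · simp [hPq]
    · simp [h P (Finset.mem_filter.2 ⟨hP, hPq⟩)]
  exact (mul_eq_zero.1 this).resolve_left hq0

lemma IsMaximalCurve.isNCorrect {k m : ℕ} {X : Finset Pt} {q : Poly2}
    (hX : IsNCorrect (k + m) X) (hq0 : q ≠ 0) (hq : IsMaximalCurve (k + m) k X q) :
    IsNCorrect m (nonzerosIn X q) := by
  refine ⟨?_, hX.eq_zero_of_vanish_nonzerosIn hq0 hq.1.le le_rfl⟩
  have h1 := card_zerosIn_add_card_nonzerosIn X q
  have h2 := d_add_Nn k m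
  rw [hq.2, hX.1] at h1
  omega

lemma mem_nonzerosIn {X : Finset Pt} {q : Poly2} {P : Pt} :
    P ∈ nonzerosIn X q ↔ P ∈ X ∧ eval P q ≠ 0 :=
  Finset.mem_filter

lemma eval_eq_zero_of_nonzerosIn_eq {X S : Finset Pt} {q : Poly2} (h : nonzerosIn X q = S)
    {P : Pt} (hP : P ∈ X) (hPS : P ∉ S) : eval P q = 0 := by
  by_contra h0
  exact hPS (h ▸ mem_nonzerosIn.2 ⟨hP, h0⟩)

/-- The product of the curve of a special triplet `{A, B, C}` with the line through `A` and `C`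
vanishes at all nodes but `B`. -/
lemma eval_line_mul_eq_zero {X : Finset Pt} {A B C : Pt} {f ℓ : Poly2}
    (hf : nonzerosIn X f = {A, B, C}) (hℓ : IsLineThrough ℓ A C) {P : Pt} (hP : P ∈ X)
    (hPB : P ≠ B) : eval P (ℓ * f) = 0 := by
  rw [map_mul, mul_eq_zero]
  by_cases hPS : P ∈ ({A, B, C} : Finset Pt)
  · left
    simp only [Finset.mem_insert, Finset.mem_singleton] at hPS
    rcases hPS with rfl | rfl | rfl
    exacts [hℓ.2.1, absurd rfl hPB, hℓ.2.2]
  · exact Or.inr (eval_eq_zero_of_nonzerosIn_eq hf hP hPS)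

/-- A line through two nodes of a special triplet, times the curve of the triplet, does not
vanish at the third node. -/
lemma eval_line_mul_ne_zero {n : ℕ} {X : Finset Pt} (hX : IsNCorrect n X) {A B C : Pt}
    {f ℓ : Poly2} (hf0 : f ≠ 0) (hf : nonzerosIn X f = {A, B, C}) (hℓ : IsLineThrough ℓ A C)
    (hdeg : (ℓ * f).totalDegree ≤ n) : eval B (ℓ * f) ≠ 0 := by
  intro h0
  refine mul_ne_zero hℓ.1.ne_zero hf0 (hX.2 _ hdeg fun P hP => ?_)
  by_cases hPB : P = B
  · rwa [hPB]
  · exact eval_line_mul_eq_zero hf hℓ hP hPB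

/-- If `{A, B, C}` and `{D, B, E}` are special triplets and `D` lies on the line through `A`
and `C`, then the two triplets coincide. -/
lemma pair_eq_of_isSpecialTriplet {n : ℕ} (hn : 1 ≤ n) {X : Finset Pt} (hX : IsNCorrect n X)
    {A B C D E : Pt} (h : IsSpecialTriplet n X A B C) (h' : IsSpecialTriplet n X B D E)
    {ℓ : Poly2} (hℓ : IsLineThrough ℓ A C) (hD : eval D ℓ = 0) :
    ({D, E} : Finset Pt) = {A, C} := by
  obtain ⟨-, -, -, hAB, -, hBC, f, ⟨hfd, -⟩, hf⟩ := h
  obtain ⟨-, hDX, -, hBD, hBE, hDE, g, ⟨hgd, -⟩, hg⟩ := h'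
  obtain ⟨ℓ', hℓ'⟩ := exists_line_through hDE
  have hBf : B ∈ X ∧ eval B f ≠ 0 := mem_nonzerosIn.1 (by simp [hf])
  have hDg : D ∈ X ∧ eval D g ≠ 0 := mem_nonzerosIn.1 (by simp [hg])
  have hf0 : f ≠ 0 := by rintro rfl; simp at hBf
  have hg0 : g ≠ 0 := by rintro rfl; simp at hDg
  have hg' : nonzerosIn X g = {D, B, E} := by rw [hg, Finset.insert_comm]
  have hdf : (ℓ * f).totalDegree ≤ n :=
    (totalDegree_mul _ _).trans (by rw [hfd, hℓ.1]; omega)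
  have hdg : (ℓ' * g).totalDegree ≤ n :=
    (totalDegree_mul _ _).trans (by rw [hgd, hℓ'.1]; omega)
  have ha := eval_line_mul_ne_zero hX hf0 hf hℓ hdf
  have hb := eval_line_mul_ne_zero hX hg0 hg' hℓ' hdg
  have hprop := proportional_of_vanish hX hdf hdg
    (fun P hP hPB => eval_line_mul_eq_zero hf hℓ hP hPB)
    (fun P hP hPB => eval_line_mul_eq_zero hg' hℓ' hP hPB)
  set a := eval B (ℓ * f)
  set b := eval B (ℓ' * g)
  have hdvd : ℓ ∣ MvPolynomial.C a * (ℓ' * g) :=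
    ⟨MvPolynomial.C b * f, by rw [← hprop]; ring⟩
  have hdvd' : ℓ ∣ ℓ' * g := by
    rcases hℓ.1.prime.dvd_or_dvd hdvd with ⟨r, hr⟩ | h
    · have := congrArg (eval D) hr
      simp [hD, ha] at this
    · exact h
  rcases hℓ.1.prime.dvd_or_dvd hdvd' with ⟨r, hr⟩ | ⟨r, hr⟩
  · have hr0 : r ≠ 0 := by rintro rfl; exact hℓ'.1.ne_zero (by simpa using hr)
    have hrd : r.totalDegree = 0 := by
      have := congrArg totalDegree hr
      rw [totalDegree_mul_of_isDomain hℓ.1.ne_zero hr0, hℓ.1, hℓ'.1] at this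
      omega
    obtain ⟨c, rfl⟩ : ∃ c, r = MvPolynomial.C c := ⟨_, totalDegree_eq_zero_iff_eq_C.1 hrd⟩
    have hc : c ≠ 0 := by rintro rfl; simp at hr0
    have hfg : MvPolynomial.C b * f = MvPolynomial.C (a * c) * g := by
      apply mul_left_cancel₀ hℓ.1.ne_zero
      rw [hr] at hprop
      rw [map_mul]
      linear_combination hprop
    have hset : nonzerosIn X f = nonzerosIn X g := by
      ext P
      have := congrArg (eval P) hfg
      simp only [map_mul, eval_C] at this
      rw [mem_nonzerosIn, mem_nonzerosIn]
      refine and_congr_right fun _ => not_congr ⟨fun h => ?_, fun h => ?_⟩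
      · simpa [h, ha, hc] using this.symm
      · simpa [h, hb] using this
    rw [hf, hg, Finset.insert_comm] at hset
    have := congrArg (fun S => S.erase B) hset
    simpa [hAB.symm, hBC, hBD, hBE] using this.symm
  · refine absurd ?_ hDg.2
    rw [hr, map_mul, hD, zero_mul]

/-- If the special triplet `{A, B, C}` has `A` on a maximal curve `ℓ * ν`, where `ℓ` is the line
through `A` and `C`, and `B` off it, then `ν` divides the curve of the triplet. -/
lemma dvd_curve_of_isMaximalCurve {j m : ℕ} {X : Finset Pt} (hX : IsNCorrect (j + 1 + m) X)
    {A B C : Pt} {ℓ ν f : Poly2} (hμ : IsMaximalCurve (j + 1 + m) (j + 1) X (ℓ * ν))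
    (hBX : B ∈ X) (hB : eval B (ℓ * ν) ≠ 0) (hℓ : IsLineThrough ℓ A C)
    (hfd : f.totalDegree = j + m) (hf : nonzerosIn X f = {A, B, C}) : ν ∣ f := by
  have hμ0 : ℓ * ν ≠ 0 := by intro h; simp [h] at hB
  have hcor := hμ.isNCorrect hX hμ0
  obtain ⟨q, hqd, hqB, hq⟩ := exists_isFund hcor (mem_nonzerosIn.2 ⟨hBX, hB⟩)
  have hprop := proportional_of_vanish (B := B) hX
    (p := ℓ * ν * q) (q := ℓ * f)
    ((totalDegree_mul _ _).trans (by rw [hμ.1]; omega))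
    ((totalDegree_mul _ _).trans (by rw [hℓ.1, hfd]; omega))
    (fun P hP hPB => by
      by_cases hPμ : eval P (ℓ * ν) = 0
      · rw [map_mul, hPμ, zero_mul]
      · rw [map_mul, hq P (mem_nonzerosIn.2 ⟨hP, hPμ⟩) hPB, mul_zero])
    (fun P hP hPB => eval_line_mul_eq_zero hf hℓ hP hPB)
  rw [map_mul _ (ℓ * ν), hqB, mul_one] at hprop
  set b := eval B (ℓ * ν)
  have h1 : MvPolynomial.C b * f = ν * (MvPolynomial.C (eval B (ℓ * f)) * q) := by
    apply mul_left_cancel₀ hℓ.1.ne_zero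
    linear_combination -hprop
  refine ⟨MvPolynomial.C b⁻¹ * (MvPolynomial.C (eval B (ℓ * f)) * q), ?_⟩
  calc f = MvPolynomial.C (b⁻¹ * b) * f := by rw [inv_mul_cancel₀ hB, map_one, one_mul]
    _ = MvPolynomial.C b⁻¹ * (MvPolynomial.C b * f) := by rw [map_mul, mul_assoc]
    _ = _ := by rw [h1]; ring

/-- Theorem 1, consequences: with `μ = ℓ₁·μ'` a maximal curve of degree
`k ≤ n` for the `n`-correct set `X`, `{A,B,C}` a special triplet (`A ∈ X ∩ μ`,
`B ∈ X \ μ`, `C ∈ X`), `ℓ₁ = ℓ_{AC}` and `ℓ̇₁ = {M ∈ ℓ₁ ∩ X : μ'(M) ≠ 0}` :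
(1) `μ' = μ/ℓ₁` is a maximal curve of degree `k-1`;
(2) `ℬ_{n-k+1} := X \ μ' = (X \ μ) ∪ ℓ̇₁` is `(n-k+1)`-correct and `ℓ₁` is a maximal line
for it;
(3) `X ∩ μ' = (X ∩ μ) \ ℓ̇₁`;
(4) `{A,B,C}` is a special triplet of `ℬ_{n-k+1}` too;
(5) any special triplet `{B,D,E}` of `X` with `D ∈ ℓ̇₁` satisfies `{D,E} = {A,C}`. -/
theorem special_triplet_consequences (n k : ℕ) (X : Finset Pt)
    (hX : IsNCorrect n X) (hkn : k ≤ n)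
    (μ : Poly2) (hμ : IsMaximalCurve n k X μ)
    (A B C : Pt) (hA : A ∈ X) (hAμ : eval A μ = 0)
    (hB : B ∈ X) (hBμ : eval B μ ≠ 0) (hC : C ∈ X)
    (hsp : IsSpecialTriplet n X A B C)
    (ℓ₁ μ' : Poly2) (hline : IsLineThrough ℓ₁ A C) (hfact : μ = ℓ₁ * μ')
    (L : Finset Pt) (hL : L = X.filter fun M => eval M ℓ₁ = 0 ∧ eval M μ' ≠ 0) :
    IsMaximalCurve n (k - 1) X μ' ∧
    nonzerosIn X μ' = nonzerosIn X μ ∪ L ∧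
    IsNCorrect (n - k + 1) (nonzerosIn X μ') ∧
    IsMaximalLine (n - k + 1) (nonzerosIn X μ') ℓ₁ ∧
    zerosIn X μ' = zerosIn X μ \ L ∧
    IsSpecialTriplet (n - k + 1) (nonzerosIn X μ') A B C ∧
    (∀ D E : Pt, IsSpecialTriplet n X B D E → D ∈ L → ({D, E} : Finset Pt) = {A, C}) := by
  subst hfact
  have hk : k ≠ 0 := by
    rintro rfl
    have h0 := totalDegree_eq_zero_iff_eq_C.1 hμ.1
    rw [h0, eval_C] at hAμ hBμ
    exact hBμ hAμ
  obtain ⟨j, rfl⟩ := Nat.exists_eq_succ_of_ne_zero hk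
  obtain ⟨m, rfl⟩ := Nat.exists_eq_add_of_le hkn
  rw [Nat.succ_eq_add_one] at *
  have e1 : j + 1 + m - (j + 1) + 1 = m + 1 := by omega
  rw [e1]
  have hμ0 : ℓ₁ * μ' ≠ 0 := by intro h; simp [h] at hBμ
  have hℓ0 : ℓ₁ ≠ 0 := left_ne_zero_of_mul hμ0
  have hμ'0 : μ' ≠ 0 := right_ne_zero_of_mul hμ0
  have hμ'd : μ'.totalDegree = j := by
    have := hμ.1
    rw [totalDegree_mul_of_isDomain hℓ0 hμ'0, hline.1] at this
    omega
  obtain ⟨-, -, -, hAB, hAC, hBC, f, ⟨hfd, -⟩, hf⟩ := id hsp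
  have hfd' : f.totalDegree = j + m := by rw [hfd]; omega
  obtain ⟨q, rfl⟩ := dvd_curve_of_isMaximalCurve hX hμ hB hBμ hline hfd' hf
  have hAf : A ∈ X ∧ eval A (μ' * q) ≠ 0 := mem_nonzerosIn.1 (by simp [hf])
  have hBf : B ∈ X ∧ eval B (μ' * q) ≠ 0 := mem_nonzerosIn.1 (by simp [hf])
  have hCf : C ∈ X ∧ eval C (μ' * q) ≠ 0 := mem_nonzerosIn.1 (by simp [hf])
  rw [map_mul, mul_ne_zero_iff] at hAf hBf hCf
  have hq0 : q ≠ 0 := by intro h; simp [h] at hAf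
  have hqd : q.totalDegree = m := by
    rw [totalDegree_mul_of_isDomain hμ'0 hq0] at hfd'
    omega
  have hunion : nonzerosIn X μ' = nonzerosIn X (ℓ₁ * μ') ∪ L := by
    ext P
    simp only [hL, nonzerosIn, Finset.mem_union, Finset.mem_filter, map_mul, mul_ne_zero_iff]
    tauto
  have hzeroL : zerosIn (nonzerosIn X μ') ℓ₁ = L := by
    ext P
    simp only [hL, nonzerosIn, zerosIn, Finset.mem_filter]
    tauto
  have hdisj : Disjoint (nonzerosIn X (ℓ₁ * μ')) L := by
    rw [Finset.disjoint_left]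
    intro P hP hPL
    simp only [hL, nonzerosIn, Finset.mem_filter, map_mul, mul_ne_zero_iff] at hP hPL
    exact hP.2.1 hPL.2.1
  have hAL : A ∈ L := by rw [hL, Finset.mem_filter]; exact ⟨hA, hline.2.1, hAf.2.1⟩
  have hCL : C ∈ L := by rw [hL, Finset.mem_filter]; exact ⟨hC, hline.2.2, hCf.2.1⟩
  have hLle : L.card ≤ m + 2 := by
    have hZ : ((L.erase A).erase C).card ≤ m := by
      refine card_le_of_zeros_on_line hline hAC hqd.le hAf.2.2 fun P hP => ?_
      simp only [Finset.mem_erase, hL, Finset.mem_filter] at hP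
      obtain ⟨hPC, hPA, hPX, hPℓ, hPμ⟩ := hP
      refine ⟨hPℓ, ?_⟩
      have hPB : P ≠ B := by rintro rfl; simp [hPℓ] at hBμ
      have := eval_eq_zero_of_nonzerosIn_eq hf hPX (by simp [hPA, hPB, hPC])
      rw [map_mul, mul_eq_zero] at this
      exact this.resolve_left hPμ
    rw [Finset.card_erase_of_mem (Finset.mem_erase.2 ⟨hAC.symm, hCL⟩),
      Finset.card_erase_of_mem hAL] at hZ
    omega
  have hvan := hX.eq_zero_of_vanish_nonzerosIn hμ'0 hμ'd.le (m := m + 1) (by omega)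
  have hcard : (nonzerosIn X μ').card = (nonzerosIn X (ℓ₁ * μ')).card + L.card := by
    rw [hunion, Finset.card_union_of_disjoint hdisj]
  have hBcard := (hμ.isNCorrect hX hμ0).1
  have hge := Nn_le_card hvan
  have hsucc := Nn_succ m
  have hLcard : L.card = m + 2 := by omega
  have hcor : IsNCorrect (m + 1) (nonzerosIn X μ') := ⟨by omega, hvan⟩
  refine ⟨⟨by simpa using hμ'd, ?_⟩, hunion, hcor, ⟨hline.1, by rw [hzeroL, hLcard]⟩, ?_, ?_,
    fun D E hDE hD => ?_⟩
  · have h1 := card_zerosIn_add_card_nonzerosIn X μ'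
    have h2 := d_add_Nn j (m + 1)
    rw [show j + (m + 1) = j + 1 + m by ring] at h2
    rw [hX.1, hcor.1] at h1
    rw [Nat.add_sub_cancel]
    omega
  · ext P
    simp only [hL, zerosIn, Finset.mem_sdiff, Finset.mem_filter, map_mul, mul_eq_zero]
    tauto
  · have hset : nonzerosIn (nonzerosIn X μ') q = {A, B, C} := by
      rw [← hf]
      ext P
      simp only [mem_nonzerosIn, map_mul, mul_ne_zero_iff, and_assoc]
    refine ⟨mem_nonzerosIn.2 ⟨hA, hAf.2.1⟩, mem_nonzerosIn.2 ⟨hB, hBf.2.1⟩,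
      mem_nonzerosIn.2 ⟨hC, hCf.2.1⟩, hAB, hAC, hBC, q, ⟨by simpa using hqd, ?_⟩, hset⟩
    have h1 := card_zerosIn_add_card_nonzerosIn (nonzerosIn X μ') q
    have h2 := d_add_Nn m 1
    have h3 : Nn 1 = 3 := rfl
    rw [hset, Finset.card_eq_three.2 ⟨A, B, C, hAB, hAC, hBC, rfl⟩, hcor.1] at h1
    rw [Nat.add_sub_cancel]
    omega
  · rw [hL, Finset.mem_filter] at hD
    exact pair_eq_of_isSpecialTriplet (by omega) hX hsp hDE hline hD.2.1
end
end

section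
/- Let X be an n-correct set and suppose the 2-node lines ℓ_{A₁B} and ℓ_{A₂B} of X, with common node B, are used by nodes C₁ and C₂ respectively, where A₁, A₂, B, C₁, C₂ ∈ X and A₁ ≠ A₂. Then C₁ ≠ C₂, and C₁ = A₂ if and only if C₂ = A₁. Moreover, if C₁ ≠ A₂ (equivalently C₂ ≠ A₁), then: (1) the lines ℓ₁ := ℓ_{A₁C₁} and ℓ₂ := ℓ_{A₂C₂} are distinct components of p*_B; (2) μ_{n−2} := p*_B/(ℓ₁ℓ₂) is a maximal curve for X of degree n−2; (3) the set B₂ := X \ μ_{n−2} = {A₁, A₂, B, C₁, C₂, D} is a 2-correct set for which ℓ₁ and ℓ₂ are maximal lines, where D = ℓ₁ ∩ ℓ₂; (4) if in addition X is a GC_n set, then B, C₁, C₂ are collinear and B₂ is a GC₂ set. -/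
open MvPolynomial Finset
open scoped Classical BigOperators

noncomputable section

lemma IsLine.exists_coeff {ℓ : Poly2} (h : IsLine ℓ) :
    ∃ a b c : ℝ, ℓ = C a + C b * X 0 + C c * X 1 ∧ (b ≠ 0 ∨ c ≠ 0) := by
  have key : ℓ = C (coeff 0 ℓ) + C (coeff (Finsupp.single 0 1) ℓ) * X 0
      + C (coeff (Finsupp.single 1 1) ℓ) * X 1 := by
    ext m
    have h01 : (Finsupp.single (0 : Fin 2) 1 : Fin 2 →₀ ℕ) ≠ Finsupp.single 1 1 := by
      intro h; simpa using DFunLike.congr_fun h 0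
    have h0 : (Finsupp.single (0 : Fin 2) 1 : Fin 2 →₀ ℕ) ≠ 0 := by simp
    have h1 : (Finsupp.single (1 : Fin 2) 1 : Fin 2 →₀ ℕ) ≠ 0 := by simp
    simp only [coeff_add, coeff_C, coeff_C_mul, coeff_X]
    by_cases e0 : m = 0
    · subst e0; simp
    by_cases e1 : m = Finsupp.single 0 1
    · subst e1; simp [h01.symm, h0.symm]
    by_cases e2 : m = Finsupp.single 1 1
    · subst e2; simp [h01, h1.symm]
    rw [if_neg (Ne.symm e0), if_neg (Ne.symm e1), if_neg (Ne.symm e2)]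
    simp only [mul_zero, add_zero]
    apply coeff_eq_zero_of_totalDegree_lt
    rw [show ℓ.totalDegree = 1 from h, ← Finsupp.degree_apply, Finsupp.degree_eq_sum,
      Fin.sum_univ_two]
    by_contra hlt
    have hle : m 0 + m 1 ≤ 1 := by omega
    have hcases : (m 0 = 0 ∧ m 1 = 0) ∨ (m 0 = 1 ∧ m 1 = 0) ∨ (m 0 = 0 ∧ m 1 = 1) := by omega
    rcases hcases with ⟨p, q⟩ | ⟨p, q⟩ | ⟨p, q⟩
    · exact e0 (by ext i; fin_cases i <;> simp [p, q])
    · exact e1 (by ext i; fin_cases i <;> simp [p, q])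
    · exact e2 (by ext i; fin_cases i <;> simp [p, q])
  refine ⟨_, _, _, key, ?_⟩
  by_contra! hbc
  rw [hbc.1, hbc.2] at key
  have h' : ℓ.totalDegree = 1 := h
  rw [key] at h'
  simp at h'

lemma totalDegree_linear_le (a b c : ℝ) :
    (C a + C b * X 0 + C c * X 1 : Poly2).totalDegree ≤ 1 := by
  have hX : ∀ (r : ℝ) (i : Fin 2), (C r * X i : Poly2).totalDegree ≤ 1 := fun r i =>
    (totalDegree_mul _ _).trans (by simp)
  refine (totalDegree_add _ _).trans (max_le ((totalDegree_add _ _).trans (max_le ?_ ?_)) ?_)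
  · simp
  · exact hX _ _
  · exact hX _ _

lemma exists_lineThrough (P Q : Pt) : ∃ ℓ, IsLineThrough ℓ P Q := by
  obtain ⟨b, c, hbc, hPQ⟩ : ∃ b c : ℝ, (b ≠ 0 ∨ c ≠ 0) ∧ b * (P 0 - Q 0) + c * (P 1 - Q 1) = 0 := by
    by_cases h : P 0 - Q 0 = 0 ∧ P 1 - Q 1 = 0
    · exact ⟨1, 0, by simp, by simp [h.1]⟩
    · refine ⟨P 1 - Q 1, -(P 0 - Q 0), ?_, by ring⟩
      by_contra! h'
      exact h ⟨by linarith [h'.2], h'.1⟩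
  refine ⟨C (-(b * P 0 + c * P 1)) + C b * X 0 + C c * X 1, ?_, ?_, ?_⟩
  · refine le_antisymm (totalDegree_linear_le _ _ _) (Nat.one_le_iff_ne_zero.mpr fun h0 => ?_)
    rw [totalDegree_eq_zero_iff_eq_C] at h0
    have e0 := congrArg (eval ![0, 0]) h0
    have e1 := congrArg (eval ![1, 0]) h0
    have e2 := congrArg (eval ![0, 1]) h0
    simp only [map_add, map_mul, eval_C, eval_X] at e0 e1 e2
    norm_num at e0 e1 e2
    rcases hbc with hb | hc
    · exact hb (by linarith)
    · exact hc (by linarith)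
  · simp only [map_add, map_mul, eval_C, eval_X]; ring
  · simp only [map_add, map_mul, eval_C, eval_X]; linarith

lemma IsLineThrough.eq_C_mul {ℓ m : Poly2} {P Q : Pt} (hℓ : IsLineThrough ℓ P Q)
    (hm : IsLineThrough m P Q) (hPQ : P ≠ Q) : ∃ k : ℝ, k ≠ 0 ∧ m = C k * ℓ := by
  obtain ⟨a, b, c, e, hbc⟩ := hℓ.1.exists_coeff
  obtain ⟨a', b', c', e', hbc'⟩ := hm.1.exists_coeff
  obtain ⟨-, hP, hQ⟩ := hℓ
  obtain ⟨hml, hP', hQ'⟩ := hm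
  rw [e] at hP hQ
  rw [e'] at hP' hQ'
  simp only [map_add, map_mul, eval_C, eval_X] at hP hQ hP' hQ'
  have h1 : b * (P 0 - Q 0) + c * (P 1 - Q 1) = 0 := by linarith
  have h2 : b' * (P 0 - Q 0) + c' * (P 1 - Q 1) = 0 := by linarith
  have hdet : b * c' - b' * c = 0 := by
    by_contra hd
    refine hPQ (funext fun i => ?_)
    have hx : (b * c' - b' * c) * (P 0 - Q 0) = 0 := by linear_combination c' * h1 - c * h2
    have hy : (b * c' - b' * c) * (P 1 - Q 1) = 0 := by linear_combination b * h2 - b' * h1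
    have hx' := (mul_eq_zero.mp hx).resolve_left hd
    have hy' := (mul_eq_zero.mp hy).resolve_left hd
    fin_cases i
    · show P 0 = Q 0
      linarith
    · show P 1 = Q 1
      linarith
  obtain ⟨k, hb, hc⟩ : ∃ k : ℝ, b' = k * b ∧ c' = k * c := by
    rcases hbc with h | h
    · refine ⟨b' / b, by field_simp, ?_⟩
      field_simp
      linarith
    · refine ⟨c' / c, ?_, by field_simp⟩
      field_simp
      linarith
  have ha : a' = k * a := by rw [hb, hc] at hP'; linear_combination hP' - k * hP
  have hk : m = C k * ℓ := by
    rw [e, e', ha, hb, hc]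
    simp only [C_mul]
    ring
  refine ⟨k, ?_, hk⟩
  rintro rfl
  exact hml.ne_zero (by simpa using hk)

lemma IsLineThrough.eval_eq_zero {ℓ m : Poly2} {P Q R : Pt} (hℓ : IsLineThrough ℓ P Q)
    (hm : IsLineThrough m P Q) (hPQ : P ≠ Q) (hR : eval R ℓ = 0) : eval R m = 0 := by
  obtain ⟨k, -, rfl⟩ := hℓ.eq_C_mul hm hPQ
  simp [hR]

/-- At most five points of the plane always lie on a conic. -/
lemma exists_conic (S : Finset Pt) (hS : S.card ≤ 5) :
    ∃ k : Poly2, k ≠ 0 ∧ k.totalDegree ≤ 2 ∧ ∀ P ∈ S, eval P k = 0 := by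
  let conic : (Fin 6 → ℝ) → Poly2 := fun v =>
    C (v 0) + C (v 1) * X 0 + C (v 2) * X 1 + C (v 3) * X 0 ^ 2 + C (v 4) * (X 0 * X 1)
      + C (v 5) * X 1 ^ 2
  have heval : ∀ v P, eval P (conic v) = v 0 + v 1 * P 0 + v 2 * P 1 + v 3 * P 0 ^ 2
      + v 4 * (P 0 * P 1) + v 5 * P 1 ^ 2 := fun v P => by simp [conic]
  let f : (Fin 6 → ℝ) →ₗ[ℝ] (S → ℝ) :=
    { toFun := fun v P => eval P.1 (conic v)
      map_add' := fun v w => by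
        ext P
        simp only [heval, Pi.add_apply]
        ring
      map_smul' := fun r v => by
        ext P
        simp only [heval, Pi.smul_apply, smul_eq_mul, RingHom.id_apply]
        ring }
  have hker : LinearMap.ker f ≠ ⊥ := by
    refine f.ker_ne_bot_of_finrank_lt ?_
    simp only [Module.finrank_fintype_fun_eq_card, Fintype.card_coe, Fintype.card_fin]
    omega
  obtain ⟨v, hv, hv0⟩ := (Submodule.ne_bot_iff _).mp hker
  refine ⟨conic v, fun h0 => hv0 ?_, ?_, fun P hP => ?_⟩
  · have h (x y : ℝ) : v 0 + v 1 * x + v 2 * y + v 3 * x ^ 2 + v 4 * (x * y) + v 5 * y ^ 2 = 0 := by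
      have := heval v ![x, y]
      rw [h0, map_zero] at this
      simpa using this.symm
    have h1 := h 0 0
    have h2 := h 1 0
    have h3 := h (-1) 0
    have h4 := h 0 1
    have h5 := h 0 (-1)
    have h6 := h 1 1
    norm_num at h1 h2 h3 h4 h5 h6
    ext i
    fin_cases i <;> simp <;> linarith
  · have hC : ∀ (r : ℝ) (p : Poly2), p.totalDegree ≤ 2 → (C r * p).totalDegree ≤ 2 :=
      fun r p hp => (totalDegree_mul _ _).trans (by simpa using hp)
    have hadd : ∀ p q : Poly2, p.totalDegree ≤ 2 → q.totalDegree ≤ 2 → (p + q).totalDegree ≤ 2 :=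
      fun p q hp hq => (totalDegree_add _ _).trans (max_le hp hq)
    refine hadd _ _ (hadd _ _ (hadd _ _ (hadd _ _ (hadd _ _ ?_ ?_) ?_) ?_) ?_) ?_
    · simp
    · exact hC _ _ (by simp)
    · exact hC _ _ (by simp)
    · exact hC _ _ (by simp)
    · exact hC _ _ ((totalDegree_mul _ _).trans (by simp))
    · exact hC _ _ (by simp)
  · exact congrFun (LinearMap.mem_ker.mp hv) ⟨P, hP⟩

/-- Polynomials vanishing at all nodes but `A` are proportional. -/
lemma IsNCorrect.proportional {n : ℕ} {X : Finset Pt} (hX : IsNCorrect n X) {A : Pt} {p q : Poly2}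
    (hp : p.totalDegree ≤ n) (hq : q.totalDegree ≤ n)
    (hpX : ∀ P ∈ X, P ≠ A → eval P p = 0) (hqX : ∀ P ∈ X, P ≠ A → eval P q = 0) :
    C (eval A q) * p = C (eval A p) * q := by
  rw [← sub_eq_zero]
  apply hX.2
  · refine (totalDegree_sub _ _).trans (max_le ?_ ?_)
    · exact (totalDegree_mul _ _).trans (by simpa using hp)
    · exact (totalDegree_mul _ _).trans (by simpa using hq)
  · intro P hP
    by_cases h : P = A
    · subst h; simp [mul_comm]
    · simp [hpX P hP h, hqX P hP h]

/-- `q` is a nonzero polynomial of degree less than `n` vanishing at all nodes of `X` except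
possibly at `P`, `Q` and `R`. -/
structure IsTriple (n : ℕ) (X : Finset Pt) (q : Poly2) (P Q R : Pt) : Prop where
  ne_zero : q ≠ 0
  degree : q.totalDegree + 1 ≤ n
  vanish : ∀ T ∈ X, T ≠ P → T ≠ Q → T ≠ R → eval T q = 0

namespace IsTriple

variable {n : ℕ} {X : Finset Pt} {q : Poly2} {P Q R : Pt}

lemma swap (h : IsTriple n X q P Q R) : IsTriple n X q Q P R :=
  ⟨h.1, h.2, fun T hT a b c => h.3 T hT b a c⟩

lemma rotate (h : IsTriple n X q P Q R) : IsTriple n X q Q R P :=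
  ⟨h.1, h.2, fun T hT a b c => h.3 T hT c a b⟩

lemma mul_degree (h : IsTriple n X q P Q R) {m : Poly2} (hm : IsLine m) :
    (m * q).totalDegree ≤ n := by
  have h1 := totalDegree_mul m q
  have h2 : m.totalDegree = 1 := hm
  have h3 := h.degree
  omega

lemma mul_vanish (h : IsTriple n X q P Q R) {m : Poly2} (hm : IsLineThrough m P Q) :
    ∀ T ∈ X, T ≠ R → eval T (m * q) = 0 := by
  intro T hT hR
  rw [map_mul]
  by_cases hP : T = P
  · rw [hP, hm.2.1, zero_mul]
  by_cases hQ : T = Q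
  · rw [hQ, hm.2.2, zero_mul]
  rw [h.vanish T hT hP hQ hR, mul_zero]

lemma eval_mul_ne_zero (hX : IsNCorrect n X) (h : IsTriple n X q P Q R) {m : Poly2}
    (hm : IsLineThrough m P Q) : eval R (m * q) ≠ 0 := by
  intro h0
  refine mul_ne_zero hm.1.ne_zero h.ne_zero (hX.2 _ (h.mul_degree hm.1) fun T hT => ?_)
  by_cases hR : T = R
  · rwa [hR]
  · exact h.mul_vanish hm T hT hR

lemma eval_line_ne_zero (hX : IsNCorrect n X) (h : IsTriple n X q P Q R) {m : Poly2}
    (hm : IsLineThrough m P Q) : eval R m ≠ 0 := by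
  have := h.eval_mul_ne_zero hX hm
  rw [map_mul] at this
  exact left_ne_zero_of_mul this

lemma eval_ne_zero (hX : IsNCorrect n X) (h : IsTriple n X q P Q R) : eval R q ≠ 0 := by
  obtain ⟨m, hm⟩ := exists_lineThrough P Q
  have := h.eval_mul_ne_zero hX hm
  rw [map_mul] at this
  exact right_ne_zero_of_mul this

/-- Two triples sharing the nodes `P` and `Q`: the third nodes are collinear with `P`. -/
lemma eval_third_eq_zero (hX : IsNCorrect n X) {q' : Poly2} {R' : Pt}
    (h : IsTriple n X q P Q R) (h' : IsTriple n X q' P Q R') {m m' : Poly2}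
    (hm : IsLineThrough m R P) (hm' : IsLineThrough m' R' P) : eval R m' = 0 := by
  have hdvd : m ∣ C (eval Q (m * q)) * (m' * q') := by
    rw [← hX.proportional (h.mul_degree hm.1) (h'.mul_degree hm'.1)
      (h.rotate.rotate.mul_vanish hm) (h'.rotate.rotate.mul_vanish hm')]
    exact ((dvd_mul_right m q).mul_left _)
  rcases hm.1.prime.dvd_or_dvd hdvd with hc | hc
  · obtain ⟨r, hr⟩ := hc
    have := congrArg (eval P) hr
    rw [map_mul (eval P), hm.2.2, zero_mul, eval_C] at this
    exact absurd this (h.rotate.rotate.eval_mul_ne_zero hX hm)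
  rcases hm.1.prime.dvd_or_dvd hc with ⟨r, rfl⟩ | ⟨r, rfl⟩
  · rw [map_mul, hm.2.1, zero_mul]
  · refine absurd ?_ (h'.rotate.eval_ne_zero hX)
    rw [map_mul, hm.2.2, zero_mul]

lemma third_unique (hX : IsNCorrect n X) {q' : Poly2} {R' : Pt}
    (h : IsTriple n X q P Q R) (h' : IsTriple n X q' P Q R') : R = R' := by
  by_contra hne
  obtain ⟨m, hm⟩ := exists_lineThrough R P
  obtain ⟨m', hm'⟩ := exists_lineThrough R' P
  obtain ⟨l, hl⟩ := exists_lineThrough R Q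
  obtain ⟨l', hl'⟩ := exists_lineThrough R' Q
  have e1 := h.eval_third_eq_zero hX h' hm hm'
  have e2 := h.swap.eval_third_eq_zero hX h'.swap hl hl'
  have e3 : eval Q m' = 0 :=
    IsLineThrough.eval_eq_zero ⟨hl'.1, e2, hl'.2.1⟩ ⟨hm'.1, e1, hm'.2.1⟩ hne hl'.2.2
  exact h'.rotate.rotate.eval_line_ne_zero hX hm' e3

end IsTriple

lemma IsTwoNodeLineOf.mem_iff {X : Finset Pt} {ℓ : Poly2} {A B : Pt} (h : IsTwoNodeLineOf X ℓ A B)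
    {P : Pt} (hP : P ∈ X) : eval P ℓ = 0 ↔ P = A ∨ P = B := by
  have := congrArg (P ∈ ·) h.2.2
  simpa [zerosIn, hP] using this

lemma IsTwoNodeLineOf.exists_triple {n : ℕ} {X : Finset Pt} {ℓ : Poly2} {A B K : Pt}
    (h : IsTwoNodeLineOf X ℓ A B) (hK : K ∈ X) (hu : Uses n X K ℓ) :
    ∃ q, IsFund n X K (ℓ * q) ∧ IsTriple n X q A B K ∧ K ≠ A ∧ K ≠ B := by
  obtain ⟨_, hp, q, rfl⟩ := hu
  have hne : ℓ * q ≠ 0 := by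
    intro h0
    have := hp.2.1
    rw [h0, map_zero] at this
    exact zero_ne_one this
  have hKℓ : eval K ℓ ≠ 0 := by
    intro h0
    have := hp.2.1
    rw [map_mul, h0, zero_mul] at this
    exact zero_ne_one this
  rw [Ne, h.mem_iff hK, not_or] at hKℓ
  have hq := right_ne_zero_of_mul hne
  refine ⟨q, hp, ⟨hq, ?_, fun T hT hA hB hTK => ?_⟩, hKℓ⟩
  · have := hp.1
    rw [totalDegree_mul_of_isDomain h.1.ne_zero hq, show ℓ.totalDegree = 1 from h.1] at this
    omega
  · have := hp.2.2 T hT hTK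
    rw [map_mul, mul_eq_zero, h.mem_iff hT] at this
    tauto

lemma IsFund.ne_zero {n : ℕ} {X : Finset Pt} {A : Pt} {p : Poly2} (h : IsFund n X A p) :
    p ≠ 0 := by
  rintro rfl
  simpa using h.2.1

lemma IsFund.totalDegree_eq {n : ℕ} {X : Finset Pt} {A : Pt} {p : Poly2} (hX : IsNCorrect n X)
    (h : IsFund n X A p) : p.totalDegree = n := by
  refine le_antisymm h.1 (not_lt.mp fun hlt => ?_)
  obtain ⟨m, hm⟩ := exists_lineThrough A A
  refine mul_ne_zero hm.1.ne_zero h.ne_zero (hX.2 _ ?_ fun P hP => ?_)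
  · have h1 := totalDegree_mul m p
    have h2 : m.totalDegree = 1 := hm.1
    omega
  · by_cases hPA : P = A
    · rw [hPA, map_mul, hm.2.1, zero_mul]
    · rw [map_mul, h.2.2 P hP hPA, mul_zero]

lemma IsTriple.mul_eq_fund {n : ℕ} {X : Finset Pt} (hX : IsNCorrect n X) {q p m : Poly2}
    {P Q R : Pt} (h : IsTriple n X q P Q R) (hm : IsLineThrough m P Q) (hp : IsFund n X R p) :
    ∃ c : ℝ, c ≠ 0 ∧ m * q = C c * p := by
  refine ⟨_, h.eval_mul_ne_zero hX hm, ?_⟩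
  have := hX.proportional (h.mul_degree hm.1) hp.1 (h.mul_vanish hm) hp.2.2
  rwa [hp.2.1, C_1, one_mul] at this

lemma eval_mul_eq_zero_of_nonzerosIn {X : Finset Pt} {μ p : Poly2}
    (h : ∀ P ∈ nonzerosIn X μ, eval P p = 0) {P : Pt} (hP : P ∈ X) : eval P (p * μ) = 0 := by
  by_cases h0 : eval P μ = 0
  · rw [map_mul, h0, mul_zero]
  · rw [map_mul, h P (by simp [nonzerosIn, hP, h0]), zero_mul]

lemma IsNCorrect.eq_zero_of_nonzerosIn {n k : ℕ} {X : Finset Pt} (hX : IsNCorrect n X)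
    {μ p : Poly2} (hμ : μ ≠ 0) (hμd : μ.totalDegree + k ≤ n) (hp : p.totalDegree ≤ k)
    (h : ∀ P ∈ nonzerosIn X μ, eval P p = 0) : p = 0 := by
  refine (mul_eq_zero.mp (hX.2 (p * μ) ?_ fun P hP => ?_)).resolve_right hμ
  · have := totalDegree_mul p μ
    omega
  · exact eval_mul_eq_zero_of_nonzerosIn h hP

lemma IsNCorrect.six_le_card_nonzerosIn {n : ℕ} {X : Finset Pt} (hX : IsNCorrect n X)
    {μ : Poly2} (hμ : μ ≠ 0) (hμd : μ.totalDegree + 2 ≤ n) : 6 ≤ (nonzerosIn X μ).card := by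
  by_contra! hlt
  obtain ⟨k, hk, hkd, hk0⟩ := exists_conic (nonzerosIn X μ) (by omega)
  exact hk (hX.eq_zero_of_nonzerosIn hμ hμd hkd hk0)

lemma exists_fund_two {S : Finset Pt} (hS : IsNCorrect 2 S) {A : Pt} (hA : A ∈ S) :
    ∃ p, IsFund 2 S A p := by
  have hcard : (S.erase A).card ≤ 5 := by
    rw [Finset.card_erase_of_mem hA, hS.1]
    rfl
  obtain ⟨k, hk, hkd, hk0⟩ := exists_conic (S.erase A) hcard
  have hkA : eval A k ≠ 0 := by
    intro h0
    refine hk (hS.2 k hkd fun P hP => ?_)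
    by_cases hPA : P = A
    · rwa [hPA]
    · exact hk0 P (Finset.mem_erase.mpr ⟨hPA, hP⟩)
  refine ⟨C (eval A k)⁻¹ * k, ?_, ?_, fun P hP hPA => ?_⟩
  · exact (totalDegree_mul _ _).trans (by simpa using hkd)
  · simp [hkA]
  · simp [hk0 P (Finset.mem_erase.mpr ⟨hPA, hP⟩)]

lemma totalDegree_prod_of_isLine {ι : Type*} (s : Finset ι) (g : ι → Poly2)
    (hg : ∀ i ∈ s, IsLine (g i)) : (∏ i ∈ s, g i).totalDegree = s.card := by
  induction s using Finset.induction with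
  | empty => simp
  | insert i s his ih =>
    rw [Finset.prod_insert his, Finset.card_insert_of_notMem his,
      totalDegree_mul_of_isDomain (hg i (Finset.mem_insert_self _ _)).ne_zero
        (Finset.prod_ne_zero_iff.mpr fun j hj => (hg j (Finset.mem_insert_of_mem hj)).ne_zero),
      ih fun j hj => hg j (Finset.mem_insert_of_mem hj),
      show (g i).totalDegree = 1 from hg i (Finset.mem_insert_self _ _)]
    omega

/-- In a `GC_n` set, the `2`-fundamental polynomials of the complement of a curve of degree `n - 2`
are products of two lines. -/
lemma IsGC.exists_factor {n : ℕ} {X : Finset Pt} (hGC : IsGC n X) {μ p : Poly2} (hμ : μ ≠ 0)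
    (hμd : μ.totalDegree + 2 = n) {A : Pt} (hA : A ∈ X) (hp : IsFund 2 (nonzerosIn X μ) A p) :
    ∃ g : Fin 2 → Poly2, (∀ i, (g i).totalDegree = 1) ∧ p = ∏ i, g i := by
  obtain ⟨f, hf, g, hg, rfl⟩ := hGC.2 A hA
  have hp0 := hp.ne_zero
  have hdeg : (p * μ).totalDegree ≤ n := by
    have h1 := totalDegree_mul p μ
    have h2 := hp.1
    omega
  have hvan : ∀ P ∈ X, P ≠ A → eval P (p * μ) = 0 := by
    intro P hP hPA
    by_cases h0 : eval P μ = 0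
    · rw [map_mul, h0, mul_zero]
    · rw [map_mul, hp.2.2 P (by simp [nonzerosIn, hP, h0]) hPA, zero_mul]
  have heq := hGC.1.proportional hdeg hf.1 hvan hf.2.2
  rw [hf.2.1, C_1, one_mul] at heq
  obtain ⟨t, u, b, c, htu, hdisj, hbc, hpt, hμu⟩ :=
    mul_eq_mul_prime_prod (fun i _ => IsLine.prime (hg i)) heq
  have hb : b ≠ 0 := fun h => hp0 (by rw [hpt, h, zero_mul])
  have hc : c ≠ 0 := fun h => hμ (by rw [hμu, h, zero_mul])
  have hbcd := congrArg totalDegree hbc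
  rw [totalDegree_C, totalDegree_mul_of_isDomain hb hc] at hbcd
  have hμcard : μ.totalDegree = u.card := by
    rw [hμu, totalDegree_mul_of_isDomain hc
      (Finset.prod_ne_zero_iff.mpr fun j _ => IsLine.ne_zero (hg j)),
      totalDegree_prod_of_isLine u g fun i _ => hg i]
    omega
  have hcard : t.card + u.card = n := by
    rw [← Finset.card_union_of_disjoint hdisj, htu, Finset.card_univ, Fintype.card_fin]
  obtain ⟨i, j, hij, rfl⟩ := Finset.card_eq_two.mp (show t.card = 2 by omega)
  refine ⟨![b * g i, g j], fun l => ?_, ?_⟩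
  · fin_cases l
    · show (b * g i).totalDegree = 1
      rw [totalDegree_mul_of_isDomain hb (IsLine.ne_zero (hg i)), hg i]
      omega
    · exact hg j
  · rw [hpt, Finset.prod_pair hij, Fin.prod_univ_two]
    simp [mul_assoc]

/-- Corollary 2: suppose the `2`-node lines `ℓ_{A₁B}` and `ℓ_{A₂B}` of the
`n`-correct set `X`, with common node `B`, are used by the nodes `C₁` and `C₂`
respectively (`A₁ ≠ A₂`). Then `C₁ ≠ C₂` and `C₁ = A₂ ↔ C₂ = A₁`. If moreover `C₁ ≠ A₂`:
(1) the lines `ℓ₁ = ℓ_{A₁C₁}`, `ℓ₂ = ℓ_{A₂C₂}` are distinct components of `p*_B`;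
(2) `μ_{n-2} := p*_B/(ℓ₁ℓ₂)` is a maximal curve of degree `n-2`;
(3) `ℬ₂ := X \ μ_{n-2} = {A₁, A₂, B, C₁, C₂, D}` with `D = ℓ₁ ∩ ℓ₂` is a `2`-correct set
for which `ℓ₁, ℓ₂` are maximal lines;
(4) if `X` is a `GC_n` set, then `B, C₁, C₂` are collinear and `ℬ₂` is a `GC₂` set. -/
theorem two_used_two_node_lines (n : ℕ) (X : Finset Pt) (hX : IsNCorrect n X)
    (A₁ A₂ B C₁ C₂ : Pt) (hA₁ : A₁ ∈ X) (hA₂ : A₂ ∈ X) (hB : B ∈ X)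
    (hC₁ : C₁ ∈ X) (hC₂ : C₂ ∈ X) (hA₁₂ : A₁ ≠ A₂)
    (ℓa₁ ℓa₂ : Poly2)
    (h₁ : IsTwoNodeLineOf X ℓa₁ A₁ B) (h₂ : IsTwoNodeLineOf X ℓa₂ A₂ B)
    (hu₁ : Uses n X C₁ ℓa₁) (hu₂ : Uses n X C₂ ℓa₂) :
    C₁ ≠ C₂ ∧ (C₁ = A₂ ↔ C₂ = A₁) ∧
    (C₁ ≠ A₂ →
      ∀ pB : Poly2, IsFund n X B pB →
      ∀ ℓ₁ ℓ₂ : Poly2, IsLineThrough ℓ₁ A₁ C₁ → IsLineThrough ℓ₂ A₂ C₂ →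
        (ℓ₁ * ℓ₂ ∣ pB) ∧ zeroSet ℓ₁ ≠ zeroSet ℓ₂ ∧
        ∀ μ' : Poly2, pB = ℓ₁ * ℓ₂ * μ' →
          IsMaximalCurve n (n - 2) X μ' ∧
          ∃ D : Pt, eval D ℓ₁ = 0 ∧ eval D ℓ₂ = 0 ∧
            nonzerosIn X μ' = {A₁, A₂, B, C₁, C₂, D} ∧
            IsNCorrect 2 (nonzerosIn X μ') ∧
            IsMaximalLine 2 (nonzerosIn X μ') ℓ₁ ∧
            IsMaximalLine 2 (nonzerosIn X μ') ℓ₂ ∧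
            (IsGC n X →
              (∃ L : Poly2, IsLine L ∧ eval B L = 0 ∧ eval C₁ L = 0 ∧ eval C₂ L = 0) ∧
              IsGC 2 (nonzerosIn X μ'))) :=  by
  obtain ⟨q₁, hf₁, t₁, hCA₁, hCB₁⟩ := h₁.exists_triple hC₁ hu₁
  obtain ⟨q₂, hf₂, t₂, hCA₂, hCB₂⟩ := h₂.exists_triple hC₂ hu₂
  have hA₁B : A₁ ≠ B := h₁.2.1
  have hA₂B : A₂ ≠ B := h₂.2.1
  have hCC : C₁ ≠ C₂ := by
    rintro rfl
    have heq := hX.proportional hf₁.1 hf₂.1 hf₁.2.2 hf₂.2.2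
    rw [hf₁.2.1, hf₂.2.1, C_1, one_mul, one_mul] at heq
    rcases h₁.1.prime.dvd_or_dvd (heq ▸ dvd_mul_right ℓa₁ q₁) with ⟨r, hr⟩ | ⟨r, hr⟩
    · have : eval A₁ ℓa₂ = 0 := by
        rw [hr, map_mul, (h₁.mem_iff hA₁).mpr (Or.inl rfl), zero_mul]
      rcases (h₂.mem_iff hA₁).mp this with h | h
      · exact hA₁₂ h
      · exact hA₁B h
    · refine t₂.rotate.rotate.eval_ne_zero hX ?_
      rw [hr, map_mul, (h₁.mem_iff hB).mpr (Or.inr rfl), zero_mul]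
  have hiff : C₁ = A₂ ↔ C₂ = A₁ := by
    constructor
    · rintro rfl
      exact (IsTriple.third_unique hX t₁.rotate.swap t₂).symm
    · rintro rfl
      exact (IsTriple.third_unique hX t₂.rotate.swap t₁).symm
  refine ⟨hCC, hiff, fun hne pB hpB ℓ₁ ℓ₂ hℓ₁ hℓ₂ => ?_⟩
  have hne' : C₂ ≠ A₁ := fun h => hne (hiff.mpr h)
  obtain ⟨c₁, hc₁, e₁⟩ := t₁.swap.rotate.mul_eq_fund hX hℓ₁ hpB
  obtain ⟨c₂, hc₂, e₂⟩ := t₂.swap.rotate.mul_eq_fund hX hℓ₂ hpB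
  have hnot : ¬(eval A₂ ℓ₁ = 0 ∧ eval C₂ ℓ₁ = 0) := by
    rintro ⟨ha, hc⟩
    obtain ⟨k, hk, rfl⟩ := hℓ₂.eq_C_mul ⟨hℓ₁.1, ha, hc⟩ hCA₂.symm
    have hq : ℓ₂ * (C (c₂ * k) * q₁) = ℓ₂ * (C c₁ * q₂) := by
      rw [C_mul]
      linear_combination C c₂ * e₁ - C c₁ * e₂
    have hq' := congrArg (eval A₁) (mul_left_cancel₀ hℓ₂.1.ne_zero hq)
    rw [map_mul _ _ q₁, map_mul _ _ q₂, t₂.vanish A₁ hA₁ hA₁₂ hA₁B hne'.symm, mul_zero, eval_C] at hq'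
    exact mul_ne_zero (mul_ne_zero hc₂ hk) (t₁.rotate.eval_ne_zero hX) hq'
  have dvd_of : ∀ {ℓ q : Poly2} {c : ℝ}, c ≠ 0 → ℓ * q = C c * pB → ℓ ∣ pB := by
    intro ℓ q c hc e
    refine ⟨C c⁻¹ * q, ?_⟩
    rw [mul_left_comm, e, ← mul_assoc, ← C_mul, inv_mul_cancel₀ hc, C_1, one_mul]
  refine ⟨?_, fun hz => hnot ⟨?_, ?_⟩, ?_⟩
  · obtain ⟨r, hr⟩ := dvd_of hc₁ e₁
    rcases hℓ₂.1.prime.dvd_or_dvd (hr ▸ dvd_of hc₂ e₂) with ⟨s, hs⟩ | h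
    · refine absurd ⟨?_, ?_⟩ hnot
      · rw [hs, map_mul, hℓ₂.2.1, zero_mul]
      · rw [hs, map_mul, hℓ₂.2.2, zero_mul]
    · rw [hr]
      exact mul_dvd_mul_left _ h
  · exact hz.symm.subset (show A₂ ∈ zeroSet ℓ₂ from hℓ₂.2.1)
  · exact hz.symm.subset (show C₂ ∈ zeroSet ℓ₂ from hℓ₂.2.2)
  rintro μ rfl
  have hμ : μ ≠ 0 := right_ne_zero_of_mul hpB.ne_zero
  have hμd : μ.totalDegree + 2 = n := by
    have h := hpB.totalDegree_eq hX
    rw [totalDegree_mul_of_isDomain (mul_ne_zero hℓ₁.1.ne_zero hℓ₂.1.ne_zero) hμ,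
      totalDegree_mul_of_isDomain hℓ₁.1.ne_zero hℓ₂.1.ne_zero,
      show ℓ₁.totalDegree = 1 from hℓ₁.1, show ℓ₂.totalDegree = 1 from hℓ₂.1] at h
    omega
  have eq₁ : q₁ = C c₁ * (ℓ₂ * μ) :=
    mul_left_cancel₀ hℓ₁.1.ne_zero (by linear_combination e₁)
  have eq₂ : q₂ = C c₂ * (ℓ₁ * μ) :=
    mul_left_cancel₀ hℓ₂.1.ne_zero (by linear_combination e₂)
  have ne₁ : ∀ P, eval P q₁ ≠ 0 ↔ eval P ℓ₂ ≠ 0 ∧ eval P μ ≠ 0 := by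
    intro P; simp [eq₁, hc₁]
  have ne₂ : ∀ P, eval P q₂ ≠ 0 ↔ eval P ℓ₁ ≠ 0 ∧ eval P μ ≠ 0 := by
    intro P; simp [eq₂, hc₂]
  have vA₁ := (ne₁ A₁).mp (t₁.rotate.eval_ne_zero hX)
  have vB₁ := (ne₁ B).mp (t₁.rotate.rotate.eval_ne_zero hX)
  have vC₁ := (ne₁ C₁).mp (t₁.eval_ne_zero hX)
  have vA₂ := (ne₂ A₂).mp (t₂.rotate.eval_ne_zero hX)
  have vB₂ := (ne₂ B).mp (t₂.rotate.rotate.eval_ne_zero hX)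
  have vC₂ := (ne₂ C₂).mp (t₂.eval_ne_zero hX)
  have mem_S : ∀ P, P ∈ nonzerosIn X μ ↔ P ∈ X ∧ eval P μ ≠ 0 := fun P => Finset.mem_filter
  have on_both : ∀ P ∈ nonzerosIn X μ, P ≠ A₁ → P ≠ A₂ → P ≠ B → P ≠ C₁ → P ≠ C₂ →
      eval P ℓ₁ = 0 ∧ eval P ℓ₂ = 0 := by
    intro P hP n1 n2 n3 n4 n5
    rw [mem_S] at hP
    have v1 := t₁.vanish P hP.1 n1 n3 n4
    have v2 := t₂.vanish P hP.1 n2 n3 n5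
    constructor
    · by_contra h
      exact (ne₂ P).mpr ⟨h, hP.2⟩ v2
    · by_contra h
      exact (ne₁ P).mpr ⟨h, hP.2⟩ v1
  obtain ⟨D, hDS, hD⟩ : ∃ D ∈ nonzerosIn X μ, D ∉ ({A₁, A₂, B, C₁, C₂} : Finset Pt) := by
    by_contra! hsub
    have h6 := hX.six_le_card_nonzerosIn hμ hμd.le
    have h5 := (Finset.card_le_card hsub).trans Finset.card_le_five
    omega
  simp only [Finset.mem_insert, Finset.mem_singleton, not_or] at hD
  obtain ⟨nDA₁, nDA₂, nDB, nDC₁, nDC₂⟩ := hD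
  obtain ⟨hD₁, hD₂⟩ := on_both D hDS nDA₁ nDA₂ nDB nDC₁ nDC₂
  have hS : nonzerosIn X μ = {A₁, A₂, B, C₁, C₂, D} := by
    ext P
    simp only [Finset.mem_insert, Finset.mem_singleton]
    constructor
    · intro hP
      by_contra! hn
      obtain ⟨n1, n2, n3, n4, n5, n6⟩ := hn
      obtain ⟨p1, p2⟩ := on_both P hP n1 n2 n3 n4 n5
      exact vA₂.1 (IsLineThrough.eval_eq_zero ⟨hℓ₂.1, p2, hD₂⟩ ⟨hℓ₁.1, p1, hD₁⟩ n6 hℓ₂.2.1)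
    · rintro (rfl | rfl | rfl | rfl | rfl | rfl)
      exacts [(mem_S _).mpr ⟨hA₁, vA₁.2⟩, (mem_S _).mpr ⟨hA₂, vA₂.2⟩, (mem_S _).mpr ⟨hB, vB₁.2⟩,
        (mem_S _).mpr ⟨hC₁, vC₁.2⟩, (mem_S _).mpr ⟨hC₂, vC₂.2⟩, hDS]
  have hScard : (nonzerosIn X μ).card = 6 := by
    refine le_antisymm ?_ (hX.six_le_card_nonzerosIn hμ hμd.le)
    rw [hS]
    exact Finset.card_le_six
  have hS2 : IsNCorrect 2 (nonzerosIn X μ) :=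
    ⟨hScard, fun p hp h => hX.eq_zero_of_nonzerosIn hμ hμd.le hp h⟩
  have hmax : IsMaximalCurve n (n - 2) X μ := by
    refine ⟨by omega, ?_⟩
    have hsum : (zerosIn X μ).card + (nonzerosIn X μ).card = X.card :=
      Finset.card_filter_add_card_filter_not _
    rw [hScard, hX.1, ← hμd] at hsum
    rw [← hμd, d, Nat.add_sub_cancel]
    generalize μ.totalDegree = k at hsum ⊢
    have : 2 * (k + 2) + 3 - k = k + 7 := by omega
    rw [this]
    have h2 : (k + 2 + 1) * (k + 2 + 2) = k * (k + 7) + 12 := by ring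
    rw [Nn, h2] at hsum
    omega
  refine ⟨hmax, D, hD₁, hD₂, hS, hS2, ⟨hℓ₁.1, ?_⟩, ⟨hℓ₂.1, ?_⟩, fun hGC => ?_⟩
  · have : zerosIn (nonzerosIn X μ) ℓ₁ = {A₁, C₁, D} := by
      rw [hS]
      simp [zerosIn, Finset.filter_insert, Finset.filter_singleton, hℓ₁.2.1, hℓ₁.2.2, hD₁, vA₂.1,
        vB₂.1, vC₂.1]
    rw [this]
    exact Finset.card_eq_three.mpr ⟨_, _, _, hCA₁.symm, (Ne.symm nDA₁), (Ne.symm nDC₁), rfl⟩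
  · have : zerosIn (nonzerosIn X μ) ℓ₂ = {A₂, C₂, D} := by
      rw [hS]
      simp [zerosIn, Finset.filter_insert, Finset.filter_singleton, hℓ₂.2.1, hℓ₂.2.2, hD₂, vA₁.1,
        vB₁.1, vC₁.1]
    rw [this]
    exact Finset.card_eq_three.mpr ⟨_, _, _, hCA₂.symm, (Ne.symm nDA₂), (Ne.symm nDC₂), rfl⟩
  have hGC2 : IsGC 2 (nonzerosIn X μ) := by
    refine ⟨hS2, fun A hA => ?_⟩
    obtain ⟨p, hp⟩ := exists_fund_two hS2 hA
    exact ⟨p, hp, hGC.exists_factor hμ hμd ((mem_S A).mp hA).1 hp⟩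
  refine ⟨?_, hGC2⟩
  obtain ⟨_, hp, g, hg, rfl⟩ := hGC2.2 D hDS
  have hcov : ∀ P ∈ nonzerosIn X μ, P ≠ D → eval P (g 0) = 0 ∨ eval P (g 1) = 0 := by
    intro P hP hPD
    have := hp.2.2 P hP hPD
    rwa [Fin.prod_univ_two, map_mul, mul_eq_zero] at this
  have collinear : ∀ m m' : Poly2, IsLine m → IsLine m' →
      (∀ P ∈ nonzerosIn X μ, P ≠ D → eval P m = 0 ∨ eval P m' = 0) → eval B m = 0 →
      eval C₁ m = 0 ∧ eval C₂ m = 0 := by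
    intro m m' hm hm' hcov hBm
    have cA₁ := hcov A₁ ((mem_S _).mpr ⟨hA₁, vA₁.2⟩) (Ne.symm nDA₁)
    have cA₂ := hcov A₂ ((mem_S _).mpr ⟨hA₂, vA₂.2⟩) (Ne.symm nDA₂)
    have cC₁ := hcov C₁ ((mem_S _).mpr ⟨hC₁, vC₁.2⟩) (Ne.symm nDC₁)
    have cC₂ := hcov C₂ ((mem_S _).mpr ⟨hC₂, vC₂.2⟩) (Ne.symm nDC₂)
    have only₁ : eval A₁ m = 0 → ∀ P ∈ X, eval P m = 0 → P = A₁ ∨ P = B := fun h P hP hPm =>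
      (h₁.mem_iff hP).mp (IsLineThrough.eval_eq_zero ⟨hm, h, hBm⟩
        ⟨h₁.1, (h₁.mem_iff hA₁).mpr (Or.inl rfl), (h₁.mem_iff hB).mpr (Or.inr rfl)⟩ hA₁B hPm)
    have only₂ : eval A₂ m = 0 → ∀ P ∈ X, eval P m = 0 → P = A₂ ∨ P = B := fun h P hP hPm =>
      (h₂.mem_iff hP).mp (IsLineThrough.eval_eq_zero ⟨hm, h, hBm⟩
        ⟨h₂.1, (h₂.mem_iff hA₂).mpr (Or.inl rfl), (h₂.mem_iff hB).mpr (Or.inr rfl)⟩ hA₂B hPm)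
    have on₁ : eval A₁ m' = 0 → eval C₁ m' = 0 → ∀ P, eval P m' = 0 → eval P ℓ₁ = 0 :=
      fun ha hc P => IsLineThrough.eval_eq_zero ⟨hm', ha, hc⟩ hℓ₁ hCA₁.symm
    have on₂ : eval A₂ m' = 0 → eval C₂ m' = 0 → ∀ P, eval P m' = 0 → eval P ℓ₂ = 0 :=
      fun ha hc P => IsLineThrough.eval_eq_zero ⟨hm', ha, hc⟩ hℓ₂ hCA₂.symm
    have a₁ : eval A₁ m' = 0 := by
      refine cA₁.resolve_left fun h => ?_
      refine vC₁.1 (on₂ (cA₂.resolve_left fun h' => ?_) (cC₂.resolve_left fun h' => ?_) C₁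
        (cC₁.resolve_left fun h' => ?_))
      · exact (only₁ h A₂ hA₂ h').elim hA₁₂.symm hA₂B
      · exact (only₁ h C₂ hC₂ h').elim hne' hCB₂
      · exact (only₁ h C₁ hC₁ h').elim hCA₁ hCB₁
    have a₂ : eval A₂ m' = 0 := by
      refine cA₂.resolve_left fun h => ?_
      refine vC₂.1 (on₁ a₁ (cC₁.resolve_left fun h' => ?_) C₂ (cC₂.resolve_left fun h' => ?_))
      · exact (only₂ h C₁ hC₁ h').elim hne hCB₁
      · exact (only₂ h C₂ hC₂ h').elim hCA₂ hCB₂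
    exact ⟨cC₁.resolve_right fun h => vA₂.1 (on₁ a₁ h A₂ a₂),
      cC₂.resolve_right fun h => vA₁.1 (on₂ a₂ h A₁ a₁)⟩
  rcases hcov B ((mem_S _).mpr ⟨hB, vB₁.2⟩) (Ne.symm nDB) with h | h
  · exact ⟨g 0, hg 0, h, collinear _ _ (hg 0) (hg 1) hcov h⟩
  · exact ⟨g 1, hg 1, h, collinear _ _ (hg 1) (hg 0) (fun P hP hPD => (hcov P hP hPD).symm) h⟩
end
end
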